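/- The Toda Poisson structures Π_0 and Π_1 on ℝ^5 are compatible: for every λ ∈ ℝ, the pencil bracket {f,g}_{(λ)} = {f,g}_1 − λ{f,g}_0 satisfies the Jacobi identity {f,{g,h}_{(λ)}}_{(λ)} + {g,{h,f}_{(λ)}}_{(λ)} + {h,{f,g}_{(λ)}}_{(λ)} = 0 for all smooth f, g, h : ℝ^5 → ℝ. -/

import Mathlib

open Matrix

/-- The bracket `{f,g}_Π(p) = Σ_{i,j} Π(p)_{ij} ∂f/∂u_i(p) ∂g/∂u_j(p)` on `ℝ^n` associated
to a matrix-valued function `P`. -/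
noncomputable def mbracket {n : ℕ} (P : (Fin n → ℝ) → Matrix (Fin n) (Fin n) ℝ)
    (f g : (Fin n → ℝ) → ℝ) (p : Fin n → ℝ) : ℝ :=
  ∑ i, ∑ j, P p i j * fderiv ℝ f p (Pi.single i 1) * fderiv ℝ g p (Pi.single j 1)

/-- The `i`-th component of the Hamiltonian vector field of `h` with respect to `P`. -/
noncomputable def hamVF {n : ℕ} (P : (Fin n → ℝ) → Matrix (Fin n) (Fin n) ℝ)
    (h : (Fin n → ℝ) → ℝ) (p : Fin n → ℝ) (i : Fin n) : ℝ :=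
  ∑ j, P p i j * fderiv ℝ h p (Pi.single j 1)

/-- The linear Toda Poisson tensor `Π_0` on `ℝ^5`, in Flaschka coordinates
`(a_1,a_2,b_1,b_2,b_3) = (p 0, …, p 4)`. -/
noncomputable def TPi0 (p : Fin 5 → ℝ) : Matrix (Fin 5) (Fin 5) ℝ :=
  !![0,     0,    -p 0,  p 0,   0;
     0,     0,    0,     -p 1,  p 1;
     p 0,   0,    0,     0,     0;
     -p 0,  p 1,  0,     0,     0;
     0,     -p 1, 0,     0,     0]

/-- The quadratic (Adler) Toda Poisson tensor `Π_1` on `ℝ^5`. -/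
noncomputable def TPi1 (p : Fin 5 → ℝ) : Matrix (Fin 5) (Fin 5) ℝ :=
  !![0,              p 0 * p 1 / 2,  -p 0 * p 2,   p 0 * p 3,    0;
     -p 0 * p 1 / 2, 0,              0,            -p 1 * p 3,   p 1 * p 4;
     p 0 * p 2,      0,              0,            2 * p 0 ^ 2,  0;
     -p 0 * p 3,     p 1 * p 3,      -2 * p 0 ^ 2, 0,            2 * p 1 ^ 2;
     0,              -p 1 * p 4,     0,            -2 * p 1 ^ 2, 0]

/-- The Toda pencil bracket `{f,g}_{(λ)} = {f,g}_1 − λ{f,g}_0` on `ℝ^5`. -/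
noncomputable def todaPencil (l : ℝ) (f g : (Fin 5 → ℝ) → ℝ) (p : Fin 5 → ℝ) : ℝ :=
  mbracket TPi1 f g p - l * mbracket TPi0 f g p

theorem sum_rotate {ι M : Type*} [Fintype ι] [AddCommMonoid M] (F : ι → ι → ι → M) :
    ∑ i, ∑ j, ∑ k, F i j k = ∑ i, ∑ j, ∑ k, F j k i := by
  rw [Finset.sum_comm (f := fun i j => ∑ k, F j k i)]
  exact Finset.sum_congr rfl fun i _ => Finset.sum_comm.symm

section Jacobi

variable {n : ℕ} {P : (Fin n → ℝ) → Matrix (Fin n) (Fin n) ℝ} {f g h : (Fin n → ℝ) → ℝ}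
  {p : Fin n → ℝ}

theorem mbracket_eq_neg_fderiv_hamVF (hP : (P p)ᵀ = -P p) :
    mbracket P f g p = -fderiv ℝ g p (hamVF P f p) := by
  rw [pi_eq_sum_univ' (hamVF P f p)]
  simp only [map_sum, map_smul, smul_eq_mul, hamVF, Finset.sum_mul, mbracket]
  rw [Finset.sum_comm, ← Finset.sum_neg_distrib]
  refine Finset.sum_congr rfl fun j _ => ?_
  rw [← Finset.sum_neg_distrib]
  refine Finset.sum_congr rfl fun i _ => ?_
  have hij : P p i j = -P p j i := congrFun (congrFun hP j) i
  rw [hij]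
  ring

theorem fderiv_mbracket_apply (hP : (P p)ᵀ = -P p)
    (hd : ∀ i j, DifferentiableAt ℝ (fun q => P q i j) p)
    (hg : DifferentiableAt ℝ (fderiv ℝ g) p) (hh : DifferentiableAt ℝ (fderiv ℝ h) p)
    (v : Fin n → ℝ) :
    fderiv ℝ (mbracket P g h) p v =
      ∑ i, ∑ j, fderiv ℝ (fun q => P q i j) p v * fderiv ℝ g p (Pi.single i 1) *
          fderiv ℝ h p (Pi.single j 1)
        + fderiv ℝ (fderiv ℝ g) p v (hamVF P h p)
        - fderiv ℝ (fderiv ℝ h) p v (hamVF P g p) := by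
  have hder : HasFDerivAt (mbracket P g h) _ p :=
    HasFDerivAt.fun_sum fun i _ => HasFDerivAt.fun_sum fun j _ =>
      ((hd i j).hasFDerivAt.mul (hg.hasFDerivAt.clm_apply
        (hasFDerivAt_const (Pi.single i (1 : ℝ)) p))).mul
        (hh.hasFDerivAt.clm_apply (hasFDerivAt_const (Pi.single j (1 : ℝ)) p))
  have hG : fderiv ℝ (fderiv ℝ g) p v (hamVF P h p) = ∑ i, ∑ j,
      P p i j * fderiv ℝ (fderiv ℝ g) p v (Pi.single i 1) * fderiv ℝ h p (Pi.single j 1) := by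
    rw [pi_eq_sum_univ' (hamVF P h p)]
    simp only [map_sum, map_smul, smul_eq_mul, hamVF, Finset.sum_mul]
    refine Finset.sum_congr rfl fun i _ => Finset.sum_congr rfl fun j _ => ?_
    ring
  have hH : fderiv ℝ (fderiv ℝ h) p v (hamVF P g p) = -∑ i, ∑ j,
      P p i j * fderiv ℝ g p (Pi.single i 1) * fderiv ℝ (fderiv ℝ h) p v (Pi.single j 1) := by
    rw [pi_eq_sum_univ' (hamVF P g p), Finset.sum_comm]
    simp only [map_sum, map_smul, smul_eq_mul, hamVF, Finset.sum_mul, ← Finset.sum_neg_distrib]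
    refine Finset.sum_congr rfl fun j _ => Finset.sum_congr rfl fun i _ => ?_
    have hij : P p i j = -P p j i := congrFun (congrFun hP j) i
    rw [hij]
    ring
  rw [hder.fderiv, hG, hH, sub_neg_eq_add]
  simp only [_root_.sum_apply, ← Finset.sum_add_distrib]
  refine Finset.sum_congr rfl fun i _ => Finset.sum_congr rfl fun j _ => ?_
  simp
  ring

/-- A skew-symmetric tensor whose Schouten bracket with itself vanishes defines a bracket
satisfying the Jacobi identity. -/
theorem mbracket_jacobi (hP : ∀ q, (P q)ᵀ = -P q)
    (hd : ∀ i j, DifferentiableAt ℝ (fun q => P q i j) p)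
    (hJ : ∀ i j k, fderiv ℝ (fun q => P q j k) p (P p i) +
      fderiv ℝ (fun q => P q k i) p (P p j) + fderiv ℝ (fun q => P q i j) p (P p k) = 0)
    (hf : ContDiff ℝ 2 f) (hg : ContDiff ℝ 2 g) (hh : ContDiff ℝ 2 h) :
    mbracket P f (mbracket P g h) p + mbracket P g (mbracket P h f) p
      + mbracket P h (mbracket P f g) p = 0 := by
  have hD {u : (Fin n → ℝ) → ℝ} (hu : ContDiff ℝ 2 u) : DifferentiableAt ℝ (fderiv ℝ u) p :=
    (hu.fderiv_right (m := 1) (by norm_num)).differentiable (by norm_num) p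
  have hS {u : (Fin n → ℝ) → ℝ} (hu : ContDiff ℝ 2 u) (v w : Fin n → ℝ) :
      fderiv ℝ (fderiv ℝ u) p v w = fderiv ℝ (fderiv ℝ u) p w v :=
    (hu.contDiffAt.isSymmSndFDerivAt (by simp)) v w
  have hT (u v w : (Fin n → ℝ) → ℝ) :
      ∑ i, ∑ j, fderiv ℝ (fun q => P q i j) p (hamVF P u p) *
          fderiv ℝ v p (Pi.single i 1) * fderiv ℝ w p (Pi.single j 1) =
        -∑ i, ∑ j, ∑ k, fderiv ℝ u p (Pi.single i 1) * fderiv ℝ v p (Pi.single j 1) *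
          fderiv ℝ w p (Pi.single k 1) * fderiv ℝ (fun q => P q j k) p (P p i) := by
    have hX : hamVF P u p = -∑ k, fderiv ℝ u p (Pi.single k 1) • P p k := by
      ext i
      simp only [hamVF, Pi.neg_apply, Finset.sum_apply, Pi.smul_apply, smul_eq_mul,
        ← Finset.sum_neg_distrib]
      refine Finset.sum_congr rfl fun j _ => ?_
      have hij : P p j i = -P p i j := congrFun (congrFun (hP p) i) j
      rw [hij]
      ring
    simp only [hX, map_neg, map_sum, map_smul, smul_eq_mul, neg_mul, Finset.sum_mul,
      Finset.sum_neg_distrib]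
    rw [neg_inj, sum_rotate]
    refine Finset.sum_congr rfl fun i _ => Finset.sum_congr rfl fun j _ =>
      Finset.sum_congr rfl fun k _ => ?_
    ring
  have hsum : (∑ i, ∑ j, ∑ k, fderiv ℝ f p (Pi.single i 1) * fderiv ℝ g p (Pi.single j 1) *
        fderiv ℝ h p (Pi.single k 1) * fderiv ℝ (fun q => P q j k) p (P p i))
      + (∑ i, ∑ j, ∑ k, fderiv ℝ g p (Pi.single i 1) * fderiv ℝ h p (Pi.single j 1) *
        fderiv ℝ f p (Pi.single k 1) * fderiv ℝ (fun q => P q j k) p (P p i))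
      + (∑ i, ∑ j, ∑ k, fderiv ℝ h p (Pi.single i 1) * fderiv ℝ f p (Pi.single j 1) *
        fderiv ℝ g p (Pi.single k 1) * fderiv ℝ (fun q => P q j k) p (P p i)) = 0 := by
    rw [sum_rotate fun i j k => fderiv ℝ g p (Pi.single i 1) * fderiv ℝ h p (Pi.single j 1) *
        fderiv ℝ f p (Pi.single k 1) * fderiv ℝ (fun q => P q j k) p (P p i),
      ← sum_rotate fun i j k => fderiv ℝ h p (Pi.single k 1) * fderiv ℝ f p (Pi.single i 1) *
        fderiv ℝ g p (Pi.single j 1) * fderiv ℝ (fun q => P q i j) p (P p k)]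
    simp only [← Finset.sum_add_distrib]
    refine Finset.sum_eq_zero fun i _ => Finset.sum_eq_zero fun j _ =>
      Finset.sum_eq_zero fun k _ => ?_
    linear_combination fderiv ℝ f p (Pi.single i 1) * fderiv ℝ g p (Pi.single j 1) *
      fderiv ℝ h p (Pi.single k 1) * hJ i j k
  simp only [mbracket_eq_neg_fderiv_hamVF (hP p), fderiv_mbracket_apply (hP p) hd (hD hf) (hD hg),
    fderiv_mbracket_apply (hP p) hd (hD hg) (hD hh),
    fderiv_mbracket_apply (hP p) hd (hD hh) (hD hf), hT]
  linear_combination hsum + hS hf (hamVF P g p) (hamVF P h p)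
    + hS hg (hamVF P h p) (hamVF P f p) + hS hh (hamVF P f p) (hamVF P g p)

end Jacobi

theorem differentiable_TPi0_apply (i j : Fin 5) : Differentiable ℝ fun q => TPi0 q i j := by
  fin_cases i <;> fin_cases j <;> simp [TPi0] <;> fun_prop

theorem differentiable_TPi1_apply (i j : Fin 5) : Differentiable ℝ fun q => TPi1 q i j := by
  fin_cases i <;> fin_cases j <;> simp [TPi1] <;> fun_prop

theorem fderiv_coord (p : Fin 5 → ℝ) (i : Fin 5) :
    fderiv ℝ (fun q : Fin 5 → ℝ => q i) p = ContinuousLinearMap.proj i :=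
  (hasFDerivAt_apply i p).fderiv

theorem fderiv_coord_mul_coord (p v : Fin 5 → ℝ) (i j : Fin 5) :
    fderiv ℝ (fun q : Fin 5 → ℝ => q i * q j) p v = p i * v j + p j * v i := by
  rw [fderiv_fun_mul (by fun_prop) (by fun_prop), fderiv_coord, fderiv_coord]
  simp

theorem fderiv_TPi0_apply (p v : Fin 5 → ℝ) (i j : Fin 5) :
    fderiv ℝ (fun q => TPi0 q i j) p v = TPi0 v i j := by
  fin_cases i <;> fin_cases j <;> simp [TPi0, fderiv_coord]

/-- The derivative of the quadratic tensor `TPi1` is its polarization. -/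
theorem fderiv_TPi1_apply (p v : Fin 5 → ℝ) (i j : Fin 5) :
    fderiv ℝ (fun q => TPi1 q i j) p v = TPi1 (p + v) i j - TPi1 p i j - TPi1 v i j := by
  fin_cases i <;> fin_cases j <;>
    simp [TPi1, pow_two, div_eq_mul_inv, fderiv_mul_const, fderiv_const_mul,
      fderiv_coord_mul_coord, DifferentiableAt.fun_mul, differentiableAt_apply] <;> ring

theorem TPi0_transpose (p : Fin 5 → ℝ) : (TPi0 p)ᵀ = -TPi0 p := by
  ext i j
  fin_cases i <;> fin_cases j <;> simp [TPi0]

theorem TPi1_transpose (p : Fin 5 → ℝ) : (TPi1 p)ᵀ = -TPi1 p := by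
  ext i j
  fin_cases i <;> fin_cases j <;> simp [TPi1, neg_div]

theorem todaPencil_eq_mbracket (l : ℝ) (f g : (Fin 5 → ℝ) → ℝ) :
    todaPencil l f g = mbracket (fun q => TPi1 q - l • TPi0 q) f g := by
  ext p
  simp only [todaPencil, mbracket, Finset.mul_sum, ← Finset.sum_sub_distrib, Matrix.sub_apply,
    Matrix.smul_apply, smul_eq_mul]
  refine Finset.sum_congr rfl fun i _ => Finset.sum_congr rfl fun j _ => ?_
  ring

theorem fderiv_todaPencil_tensor_apply (l : ℝ) (p v : Fin 5 → ℝ) (i j : Fin 5) :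
    fderiv ℝ (fun q => (TPi1 q - l • TPi0 q) i j) p v =
      TPi1 (p + v) i j - TPi1 p i j - TPi1 v i j - l * TPi0 v i j := by
  simp only [Matrix.sub_apply, Matrix.smul_apply, smul_eq_mul]
  rw [fderiv_fun_sub (differentiable_TPi1_apply i j p)
      ((differentiable_TPi0_apply i j p).const_mul l),
    fderiv_const_mul (differentiable_TPi0_apply i j p)]
  simp [fderiv_TPi0_apply, fderiv_TPi1_apply]

set_option maxHeartbeats 4000000 in
/-- The Schouten bracket of the pencil tensor `TPi1 - l • TPi0` with itself vanishes. -/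
theorem todaPencil_tensor_schouten (l : ℝ) (p : Fin 5 → ℝ) (i j k : Fin 5) :
    fderiv ℝ (fun q => (TPi1 q - l • TPi0 q) j k) p ((TPi1 p - l • TPi0 p) i) +
      fderiv ℝ (fun q => (TPi1 q - l • TPi0 q) k i) p ((TPi1 p - l • TPi0 p) j) +
      fderiv ℝ (fun q => (TPi1 q - l • TPi0 q) i j) p ((TPi1 p - l • TPi0 p) k) = 0 := by
  simp only [fderiv_todaPencil_tensor_apply]
  fin_cases i <;> fin_cases j <;> fin_cases k <;> simp [TPi0, TPi1] <;> ring

/-- The Toda Poisson structures `Π_0` and `Π_1` on `ℝ^5` are compatible: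
every pencil bracket `{·,·}_1 − λ{·,·}_0` satisfies the Jacobi identity. -/
theorem TPi0_TPi1_compatible (l : ℝ) (f g h : (Fin 5 → ℝ) → ℝ)
    (hf : ContDiff ℝ (⊤ : ℕ∞) f) (hg : ContDiff ℝ (⊤ : ℕ∞) g) (hh : ContDiff ℝ (⊤ : ℕ∞) h) :
    ∀ p : Fin 5 → ℝ,
      todaPencil l f (todaPencil l g h) p
        + todaPencil l g (todaPencil l h f) p
        + todaPencil l h (todaPencil l f g) p = 0 := by
  intro p
  have two_le : (2 : WithTop ℕ∞) ≤ ((⊤ : ℕ∞) : WithTop ℕ∞) :=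
    WithTop.coe_le_coe.2 (le_top : (2 : ℕ∞) ≤ ⊤)
  simp only [todaPencil_eq_mbracket]
  refine mbracket_jacobi (fun q => ?_) (fun i j => ?_) (fun i j k => ?_)
    (hf.of_le two_le) (hg.of_le two_le) (hh.of_le two_le)
  · rw [transpose_sub, transpose_smul, TPi0_transpose, TPi1_transpose, smul_neg, neg_sub_neg,
      neg_sub]
  · exact (differentiable_TPi1_apply i j p).sub ((differentiable_TPi0_apply i j p).const_mul l)
  · exact todaPencil_tensor_schouten l p i j k
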